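/- Let A_{f,g} be a densely defined control Liouville operator on a scalar RKHS H̃ of continuously differentiable functions over ℝⁿ, mapping into a vector valued RKHS H of ℝ^{1×(m+1)}-valued functions. Let u : [0,T] → ℝ^m be a bounded measurable control signal whose corresponding Carathéodory solution γ_u of ẋ = f(x) + g(x)u(t) is bounded on [0,T]. Then the control occupation kernel Γ_{γ_u,u} lies in the domain of the adjoint A_{f,g}*, and A_{f,g}* Γ_{γ_u,u} = K̃(·, γ_u(T)) − K̃(·, γ_u(0)). -/

import Mathlib

open MeasureTheory
open scoped RealInnerProductSpace

/-- The augmented control vector `(1, u)ᵀ ∈ ℝ^{m+1}` built from `u ∈ ℝ^m`. -/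
noncomputable def aug {m : ℕ} (u : EuclideanSpace ℝ (Fin m)) :
    EuclideanSpace ℝ (Fin (m + 1)) :=
  (WithLp.equiv 2 (Fin (m + 1) → ℝ)).symm
    (Fin.cons 1 ((WithLp.equiv 2 (Fin m → ℝ)) u))

/-- The action of the control Liouville operator: `h ↦ (x ↦ ∇h(x) [f(x) g(x)])`, where the
columns of `g(x)` are `g x 0, …, g x (m-1)`. The value at `x` is the row vector
`(∇h(x)·f(x), ∇h(x)·g₁(x), …, ∇h(x)·g_m(x)) ∈ ℝ^{1×(m+1)}`. -/
noncomputable def liouvAct {n m : ℕ}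
    (f : EuclideanSpace ℝ (Fin n) → EuclideanSpace ℝ (Fin n))
    (g : EuclideanSpace ℝ (Fin n) → Fin m → EuclideanSpace ℝ (Fin n))
    (h : EuclideanSpace ℝ (Fin n) → ℝ) (x : EuclideanSpace ℝ (Fin n)) :
    EuclideanSpace ℝ (Fin (m + 1)) :=
  (WithLp.equiv 2 (Fin (m + 1) → ℝ)).symm
    (Fin.cons (fderiv ℝ h x (f x)) (fun i => fderiv ℝ h x (g x i)))

lemma liouv_aux_integrable {E U : Type*} [NormedAddCommGroup E] [NormedSpace ℝ E]
    [ProperSpace E] [SecondCountableTopology E] [MeasurableSpace E] [BorelSpace E]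
    [NormedAddCommGroup U] [ProperSpace U] [SecondCountableTopology U]
    [MeasurableSpace U] [BorelSpace U]
    (G : E × U → E) (hG : Continuous G) (T : ℝ) (hT : 0 ≤ T)
    (u : ℝ → U) (hu : Measurable u) (C : ℝ) (hC : ∀ t ∈ Set.Icc (0 : ℝ) T, ‖u t‖ ≤ C)
    (γ : ℝ → E)
    (hγ : ∀ t ∈ Set.Icc (0 : ℝ) T, γ t = γ 0 + ∫ s in (0 : ℝ)..t, G (γ s, u s))
    (B : ℝ) (hB : ∀ t ∈ Set.Icc (0 : ℝ) T, ‖γ t‖ ≤ B) :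
    IntervalIntegrable (fun s => G (γ s, u s)) volume 0 T ∧
    ∃ M : ℝ, ∀ t ∈ Set.Icc (0 : ℝ) T, ‖G (γ t, u t)‖ ≤ M := by
  have hbd : ∃ M : ℝ, ∀ t ∈ Set.Icc (0 : ℝ) T, ‖G (γ t, u t)‖ ≤ M := by
    obtain ⟨M, hM⟩ := ((isCompact_closedBall (0 : E) B).prod
      (isCompact_closedBall (0 : U) C)).exists_bound_of_continuousOn hG.continuousOn
    refine ⟨M, fun t ht => hM _ ⟨?_, ?_⟩⟩
    · simpa using hB t ht
    · simpa using hC t ht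
  refine ⟨?_, hbd⟩
  obtain ⟨M, hM⟩ := hbd
  set F : ℝ → E := fun s => G (γ s, u s) with hF
  let S : Set ℝ := {t | t ∈ Set.Icc (0 : ℝ) T ∧ IntervalIntegrable F volume 0 t}
  have hSd : ∀ s ∈ S, ∀ t, 0 ≤ t → t ≤ s → t ∈ S := by
    intro s hs t h0 hts
    refine ⟨⟨h0, hts.trans hs.1.2⟩, hs.2.mono_set ?_⟩
    rw [Set.uIcc_of_le h0, Set.uIcc_of_le (h0.trans hts)]
    exact Set.Icc_subset_Icc_right hts
  have hSm : MeasurableSet S := by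
    apply Set.OrdConnected.measurableSet
    exact ⟨fun x hx y hy z hz => hSd y hy z (hx.1.1.trans hz.1) hz.2⟩
  have hcont : ∀ s ∈ S, ContinuousOn γ (Set.Icc 0 s) := by
    intro s hs
    have h1 := intervalIntegral.continuousOn_primitive_interval' hs.2 Set.left_mem_uIcc
    rw [Set.uIcc_of_le hs.1.1] at h1
    refine (continuousOn_const.add h1).congr (f := fun t => γ 0 + ∫ x in (0:ℝ)..t, F x) ?_
    intro t ht
    exact hγ t ⟨ht.1, ht.2.trans hs.1.2⟩
  have hcS : ContinuousOn γ S := by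
    intro t ht
    by_cases hex : ∃ s ∈ S, t < s
    · obtain ⟨s, hs, hts⟩ := hex
      have h1 := (hcont s hs) t ⟨ht.1.1, hts.le⟩
      refine h1.mono_of_mem_nhdsWithin ?_
      filter_upwards [self_mem_nhdsWithin, mem_nhdsWithin_of_mem_nhds (Iio_mem_nhds hts)]
        with x hx hx2
      exact ⟨hx.1.1, le_of_lt hx2⟩
    · push Not at hex
      exact ((hcont t ht) t ⟨ht.1.1, le_rfl⟩).mono (fun x hx => ⟨hx.1.1, hex x hx⟩)
  have hγS : AEStronglyMeasurable γ (volume.restrict S) := hcS.aestronglyMeasurable hSm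
  have hγc : AEStronglyMeasurable γ (volume.restrict (Set.Icc 0 T \ S)) := by
    refine (aestronglyMeasurable_const (b := γ 0)).congr ?_
    filter_upwards [ae_restrict_mem (measurableSet_Icc.diff hSm)] with t ht
    rw [hγ t ht.1, intervalIntegral.integral_undef, add_zero]
    exact fun hi => ht.2 ⟨ht.1, hi⟩
  have hγm : AEStronglyMeasurable γ (volume.restrict (Set.Icc 0 T)) := by
    have : Set.Icc 0 T = S ∪ (Set.Icc 0 T \ S) :=
      (Set.union_sdiff_cancel (fun x hx => hx.1)).symm
    rw [this, aestronglyMeasurable_union_iff]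
    exact ⟨hγS, hγc⟩
  have hFm : AEStronglyMeasurable F (volume.restrict (Set.Icc 0 T)) :=
    hG.comp_aestronglyMeasurable (hγm.prodMk hu.aestronglyMeasurable)
  rw [intervalIntegrable_iff_integrableOn_Icc_of_le hT]
  exact Integrable.of_bound hFm M
    ((ae_restrict_mem measurableSet_Icc).mono hM)

lemma liouv_aux_ftc {E : Type*} [NormedAddCommGroup E] [NormedSpace ℝ E] [CompleteSpace E]
    [ProperSpace E]
    (F : ℝ → E) (T : ℝ) (hT : 0 ≤ T) (hFi : IntervalIntegrable F volume 0 T)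
    (M : ℝ) (hM : ∀ t ∈ Set.Icc (0 : ℝ) T, ‖F t‖ ≤ M)
    (γ : ℝ → E) (hγ : ∀ t ∈ Set.Icc (0 : ℝ) T, γ t = γ 0 + ∫ s in (0 : ℝ)..t, F s)
    (B : ℝ) (hB : ∀ t ∈ Set.Icc (0 : ℝ) T, ‖γ t‖ ≤ B)
    (h : E → ℝ) (hh : ContDiff ℝ 1 h) :
    ∫ t in (0 : ℝ)..T, fderiv ℝ h (γ t) (F t) = h (γ T) - h (γ 0) := by
  set β : ℝ → E := fun t => γ 0 + ∫ s in (0 : ℝ)..t, F s with hβ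
  have hsub : ∀ t ∈ Set.Icc (0 : ℝ) T, IntervalIntegrable F volume 0 t := by
    intro t ht
    refine hFi.mono_set ?_
    rw [Set.uIcc_of_le ht.1, Set.uIcc_of_le hT]
    exact Set.Icc_subset_Icc_right ht.2
  have hL : LipschitzOnWith M.toNNReal β (Set.Icc 0 T) := by
    refine LipschitzOnWith.of_dist_le_mul ?_
    intro x hx y hy
    have h1 : β x - β y = ∫ s in y..x, F s := by
      simp only [hβ, add_sub_add_left_eq_sub]
      exact intervalIntegral.integral_interval_sub_left (hsub x hx) (hsub y hy)
    rw [dist_eq_norm, h1, Real.dist_eq]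
    refine intervalIntegral.norm_integral_le_of_norm_le_const ?_
    intro s hs
    refine (hM s ?_).trans (Real.le_coe_toNNReal M)
    exact (Set.uIcc_subset_Icc hy hx) (Set.uIoc_subset_uIcc hs)
  obtain ⟨K, hK⟩ := hh.contDiffOn.exists_lipschitzOnWith one_ne_zero
    (convex_closedBall (0 : E) B) (isCompact_closedBall (0 : E) B)
  have hmaps : Set.MapsTo β (Set.Icc 0 T) (Metric.closedBall (0 : E) B) := by
    intro t ht
    have := hB t ht
    rw [hγ t ht] at this
    simpa using this
  have hLc : LipschitzOnWith (K * M.toNNReal) (h ∘ β) (Set.uIcc 0 T) := by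
    rw [Set.uIcc_of_le hT]
    exact hK.comp hL hmaps
  have h0 : γ 0 = β 0 := by simp [hβ]
  have hTT : γ T = β T := hγ T ⟨hT, le_rfl⟩
  have hmain := hLc.absolutelyContinuousOnInterval.integral_deriv_eq_sub
  rw [h0, hTT]
  refine Eq.trans ?_ hmain
  apply intervalIntegral.integral_congr_ae
  filter_upwards [hFi.ae_hasDerivAt_integral] with t ht hmem
  have hmem' := Set.uIoc_subset_uIcc hmem
  have hd : HasDerivAt β (F t) t := (ht hmem' 0 Set.left_mem_uIcc).const_add (γ 0)
  rw [Set.uIcc_of_le hT] at hmem'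
  rw [hγ t hmem']
  have := ((hh.differentiable one_ne_zero (β t)).hasFDerivAt).comp_hasDerivAt t hd
  exact this.deriv.symm

/-- If `A_{f,g}` is a densely defined control Liouville operator from a scalar
RKHS `H̃` of continuously differentiable functions into a vvRKHS `H`, and `u` is an admissible
(bounded measurable, with bounded Carathéodory solution `γ_u`) control on `[0,T]`, then the
control occupation kernel `Γ_{γ_u,u}` lies in the domain of the adjoint `A_{f,g}^*` (i.e. the
functional `h ↦ ⟪A_{f,g}h, Γ⟫` is bounded on the domain), and
`A_{f,g}^* Γ_{γ_u,u} = K̃(·, γ_u(T)) − K̃(·, γ_u(0))`. -/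
theorem control_liouville_adjoint_occupation_kernel
    {n m : ℕ} {Ht H : Type*}
    [NormedAddCommGroup Ht] [InnerProductSpace ℝ Ht] [CompleteSpace Ht]
    [NormedAddCommGroup H] [InnerProductSpace ℝ H] [CompleteSpace H]
    -- `H̃` is a scalar RKHS of continuously differentiable functions over `ℝⁿ`
    (evt : Ht →ₗ[ℝ] (EuclideanSpace ℝ (Fin n) → ℝ))
    (hC1 : ∀ h : Ht, ContDiff ℝ 1 (evt h))
    (Kt : EuclideanSpace ℝ (Fin n) → Ht)
    (hKt : ∀ x (h : Ht), ⟪h, Kt x⟫ = evt h x)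
    -- `H` is a vvRKHS of `ℝ^{1×(m+1)}`-valued functions over `ℝⁿ`
    (ev : H →ₗ[ℝ] (EuclideanSpace ℝ (Fin n) → EuclideanSpace ℝ (Fin (m + 1))))
    -- locally Lipschitz dynamics
    (f : EuclideanSpace ℝ (Fin n) → EuclideanSpace ℝ (Fin n))
    (g : EuclideanSpace ℝ (Fin n) → Fin m → EuclideanSpace ℝ (Fin n))
    (hf : LocallyLipschitz f) (hg : LocallyLipschitz g)
    -- the control Liouville operator `A` with (dense) domain `D`
    (D : Submodule ℝ Ht) (hdense : D.topologicalClosure = ⊤)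
    (hD : ∀ h : Ht, h ∈ D ↔ ∃ p : H, ev p = liouvAct f g (evt h))
    (A : D →ₗ[ℝ] H)
    (hA : ∀ (h : Ht) (hh : h ∈ D), ev (A ⟨h, hh⟩) = liouvAct f g (evt h))
    -- admissible control on `[0,T]`: bounded measurable `u`, bounded Carathéodory solution
    (T : ℝ) (hT : 0 ≤ T)
    (u : ℝ → EuclideanSpace ℝ (Fin m)) (hu_meas : Measurable u)
    (hu_bdd : ∃ C : ℝ, ∀ t ∈ Set.Icc (0 : ℝ) T, ‖u t‖ ≤ C)
    (γ : ℝ → EuclideanSpace ℝ (Fin n))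
    (hγ : ∀ t ∈ Set.Icc (0 : ℝ) T,
      γ t = γ 0 + ∫ s in (0 : ℝ)..t,
        (f (γ s) + ∑ i, (WithLp.equiv 2 (Fin m → ℝ)) (u s) i • g (γ s) i))
    (hγ_bdd : ∃ B : ℝ, ∀ t ∈ Set.Icc (0 : ℝ) T, ‖γ t‖ ≤ B)
    -- `Γ` is the control occupation kernel corresponding to `u` and `γ` in `H`
    (Γ : H)
    (hΓ : ∀ p : H, ⟪p, Γ⟫ = ∫ t in (0 : ℝ)..T, ⟪ev p (γ t), aug (u t)⟫) :
    (∃ C : ℝ, ∀ h : D, |⟪A h, Γ⟫| ≤ C * ‖(h : Ht)‖) ∧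
    ∀ h : D, ⟪A h, Γ⟫ = ⟪(h : Ht), Kt (γ T) - Kt (γ 0)⟫ := by
  obtain ⟨C, hC⟩ := hu_bdd
  obtain ⟨B, hB⟩ := hγ_bdd
  let G : EuclideanSpace ℝ (Fin n) × EuclideanSpace ℝ (Fin m) → EuclideanSpace ℝ (Fin n) :=
    fun p => f p.1 + ∑ i, (WithLp.equiv 2 (Fin m → ℝ)) p.2 i • g p.1 i
  have hG : Continuous G := by
    have h1 := hf.continuous
    have h2 := hg.continuous
    refine (h1.comp continuous_fst).add (continuous_finsetSum _ fun i _ => ?_)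
    refine Continuous.smul (f := fun p : EuclideanSpace ℝ (Fin n) × EuclideanSpace ℝ (Fin m) =>
      (WithLp.equiv 2 (Fin m → ℝ)) p.2 i) ?_ ((continuous_apply i).comp (h2.comp continuous_fst))
    simp only [WithLp.equiv_apply]
    fun_prop
  obtain ⟨hFi, M, hM⟩ := liouv_aux_integrable G hG T hT u hu_meas C hC γ hγ B hB
  have key : ∀ h : D, ⟪A h, Γ⟫ = ⟪(h : Ht), Kt (γ T) - Kt (γ 0)⟫ := by
    intro h
    rw [hΓ, inner_sub_right, hKt, hKt,
      ← liouv_aux_ftc (fun s => G (γ s, u s)) T hT hFi M hM γ hγ B hB _ (hC1 h)]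
    congr 1
    funext t
    rw [hA h h.2]
    simp only [G, liouvAct, aug, map_add, map_sum, map_smul, PiLp.inner_apply, Fin.sum_univ_succ]
    simp
  refine ⟨⟨‖Kt (γ T) - Kt (γ 0)‖, fun h => ?_⟩, key⟩
  rw [key h, mul_comm]
  exact abs_real_inner_le_norm _ _
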